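/- Let A be a countable-dimensional unital locally matrix algebra over a field F, let 0 ≠ e ∈ A be an idempotent, and let C be a Cartan subalgebra of the algebra eAe. Then there exists a Cartan subalgebra of A containing C. -/

import Mathlib

open scoped BigOperators

noncomputable section

/-! ### Steinitz numbers -/

/-- A Steinitz number: a formal product `∏ p ^ r_p` over all primes, with exponents
`r_p ∈ ℕ ∪ {∞}`, encoded as the function sending each prime to its exponent. -/
def SteinitzNumber : Type := Nat.Primes → ℕ∞

namespace SteinitzNumber

instance : One SteinitzNumber := ⟨fun _ => 0⟩

instance : Mul SteinitzNumber := ⟨fun s t p => s p + t p⟩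

/-- The Steinitz number associated with a positive integer `n`. -/
def ofNat (n : ℕ) : SteinitzNumber := fun p => (n.factorization p : ℕ∞)

/-- `b ∈ Ω(s)`: the positive integer `b` divides the Steinitz number `s`. -/
def NatDvd (b : ℕ) (s : SteinitzNumber) : Prop :=
  0 < b ∧ ∀ p : Nat.Primes, (b.factorization p : ℕ∞) ≤ s p

/-- The quotient `s / b` of a Steinitz number by a positive integer dividing it. -/
def divNat (s : SteinitzNumber) (b : ℕ) : SteinitzNumber :=
  fun p => s p - (b.factorization p : ℕ∞)

/-- An infinite Steinitz number is one which is not a positive integer. -/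
def Infinite (s : SteinitzNumber) : Prop := ∀ n : ℕ, s ≠ ofNat n

/-- Steinitz numbers `s` and `t` are rationally connected: `t = (a/b)·s` for positive
integers `a, b` (expressed by cross multiplication). -/
def RationallyConnected (s t : SteinitzNumber) : Prop :=
  ∃ a b : ℕ, 0 < a ∧ 0 < b ∧ ofNat b * t = ofNat a * s

/-- `s₁` finitely divides `s₂`: `s₁ = s₂ / b` for some `b ∈ Ω(s₂)`. -/
def FinDvd (s₁ s₂ : SteinitzNumber) : Prop :=
  ∃ b : ℕ, NatDvd b s₂ ∧ ofNat b * s₁ = s₂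

/-- `s₁ ≤ s₂` iff `s₁ = (a/b)·s₂` with `b ∈ Ω(s₂)` and `1 ≤ a ≤ b`. -/
def Le (s₁ s₂ : SteinitzNumber) : Prop :=
  ∃ a b : ℕ, 0 < a ∧ a ≤ b ∧ NatDvd b s₂ ∧ ofNat b * s₁ = ofNat a * s₂

/-- A saturated set of Steinitz numbers. -/
def Saturated (S : Set SteinitzNumber) : Prop :=
  (∀ s₁ ∈ S, ∀ s₂ ∈ S, RationallyConnected s₁ s₂) ∧
  (∀ s₂ ∈ S, ∀ s₁, FinDvd s₁ s₂ → s₁ ∈ S) ∧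
  (∀ s ∈ S, ∀ n : ℕ, ofNat n * s ∈ S → ∀ k : ℕ, 1 ≤ k → k ≤ n → ofNat k * s ∈ S)

/-- `S(∞, s) = { (a/b)·s : a ∈ ℕ, b ∈ Ω(s) }`. -/
def SInf (s : SteinitzNumber) : Set SteinitzNumber :=
  {t | ∃ a b : ℕ, 0 < a ∧ NatDvd b s ∧ ofNat b * t = ofNat a * s}

/-- `S(r, s) = { (a/b)·s : a, b ∈ ℕ, b ∈ Ω(s), a ≤ r·b }`. -/
def SBdd (r : ℝ) (s : SteinitzNumber) : Set SteinitzNumber :=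
  {t | ∃ a b : ℕ, 0 < a ∧ NatDvd b s ∧ (a : ℝ) ≤ r * b ∧ ofNat b * t = ofNat a * s}

/-- `S⁺(r, s) = { (a/b)·s : a, b ∈ ℕ, b ∈ Ω(s), a < r·b }`. -/
def SBddPlus (r : ℝ) (s : SteinitzNumber) : Set SteinitzNumber :=
  {t | ∃ a b : ℕ, 0 < a ∧ NatDvd b s ∧ (a : ℝ) < r * b ∧ ofNat b * t = ofNat a * s}

end SteinitzNumber

/-! ### Measure algebras -/

/-- A measure algebra: a Boolean algebra (an associative, commutative algebra over `𝔽₂`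
in which every element is idempotent) equipped with a measure `μ` which is positive on
nonzero elements and additive on orthogonal pairs. -/
structure MeasureAlgebra : Type 1 where
  carrier : Type
  [ring : NonUnitalCommRing carrier]
  idem : ∀ x : carrier, x * x = x
  mu : carrier → ℝ
  mu_nonneg : ∀ a, 0 ≤ mu a
  mu_eq_zero_iff : ∀ a, mu a = 0 ↔ a = 0
  mu_add : ∀ a b : carrier, a * b = 0 → mu (a + b) = mu a + mu b

attribute [instance] MeasureAlgebra.ring

namespace MeasureAlgebra

/-- Isomorphism of measure algebras: a Boolean algebra isomorphism preserving the measures. -/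
def Isomorphic (H₁ H₂ : MeasureAlgebra) : Prop :=
  ∃ φ : H₁.carrier ≃+* H₂.carrier, ∀ a, H₂.mu (φ a) = H₁.mu a

/-- Scalar equivalence of measure algebras: a Boolean algebra isomorphism multiplying
the measure by a positive constant `α`. -/
def ScalarEquivalent (H₁ H₂ : MeasureAlgebra) : Prop :=
  ∃ α : ℝ, 0 < α ∧ ∃ φ : H₁.carrier ≃+* H₂.carrier, ∀ a, H₂.mu (φ a) = α * H₁.mu a

/-- The measure subalgebra of a measure algebra supported on a subring, with the
restricted measure. -/
def restrict (H : MeasureAlgebra) (S : NonUnitalSubring H.carrier) : MeasureAlgebra where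
  carrier := S
  idem := fun x => Subtype.ext (H.idem x.1)
  mu := fun x => H.mu x.1
  mu_nonneg := fun a => H.mu_nonneg a.1
  mu_eq_zero_iff := fun a => by
    rw [H.mu_eq_zero_iff a.1]
    exact ⟨fun h => Subtype.ext h, fun h => congrArg Subtype.val h⟩
  mu_add := fun a b hab => H.mu_add a.1 b.1 (congrArg Subtype.val hab)

/-- The standard measure algebra `Stₙ = 𝔽₂ⁿ` with `μ(x₁, …, xₙ) = (x₁ + ⋯ + xₙ)/n`. -/
def St (n : ℕ) : MeasureAlgebra where
  carrier := Fin n → ZMod 2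
  idem := fun x => funext fun i => by
    have h : ∀ a : ZMod 2, a * a = a := by decide
    exact h (x i)
  mu := fun x => (∑ i, ((x i).val : ℝ)) / n
  mu_nonneg := fun a => by positivity
  mu_eq_zero_iff := fun a => by
    constructor
    · intro h
      rcases Nat.eq_zero_or_pos n with hn | hn
      · subst hn; exact funext fun i => i.elim0
      · have hne : ((n : ℝ)) ≠ 0 := by positivity
        have h2 : (∑ i, ((a i).val : ℝ)) = 0 := by
          rcases div_eq_zero_iff.mp h with h' | h'
          · exact h'
          · exact absurd h' hne
        have h3 := (Finset.sum_eq_zero_iff_of_nonneg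
          (fun i _ => by positivity : ∀ i ∈ Finset.univ, (0:ℝ) ≤ ((a i).val : ℝ))).mp h2
        funext i
        have h4 : ((a i).val : ℝ) = 0 := h3 i (Finset.mem_univ i)
        have h5 : (a i).val = 0 := by exact_mod_cast h4
        exact (ZMod.val_eq_zero _).mp h5
    · intro h; subst h; simp
  mu_add := fun a b hab => by
    have key : ∀ u v : ZMod 2, u * v = 0 → (u + v).val = u.val + v.val := by decide
    have h : ∀ i, (((a + b) i).val : ℝ) = ((a i).val : ℝ) + ((b i).val : ℝ) := by
      intro i
      have h0 : a i * b i = 0 := congrFun hab i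
      have h1 := key (a i) (b i) h0
      show (((a i + b i)).val : ℝ) = _
      rw [h1]
      push_cast
      ring
    show (∑ i, (((a + b) i).val : ℝ)) / n
        = (∑ i, ((a i).val : ℝ)) / n + (∑ i, ((b i).val : ℝ)) / n
    rw [← add_div, ← Finset.sum_add_distrib]
    congr 1
    exact Finset.sum_congr rfl fun i _ => h i

/-- A measure algebra is unital if it has an identity element of measure `1`. -/
def Unital (H : MeasureAlgebra) : Prop :=
  ∃ e : H.carrier, (∀ x, e * x = x) ∧ H.mu e = 1

/-- A measure algebra is locally standard if every finite subset is contained in a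
measure subalgebra scalar equivalent to a standard one. -/
def LocallyStandard (H : MeasureAlgebra) : Prop :=
  ∀ t : Finset H.carrier, ∃ (S : NonUnitalSubring H.carrier) (n : ℕ), 0 < n ∧
    (↑t : Set H.carrier) ⊆ S ∧ (H.restrict S).ScalarEquivalent (St n)

/-- For an (idempotent) element `h`, the subring `hH = {x | h·x = x}`. -/
def cornerSubring (H : MeasureAlgebra) (h : H.carrier) : NonUnitalSubring H.carrier where
  carrier := {x | h * x = x}
  zero_mem' := mul_zero h
  add_mem' := by
    intro a b ha hb
    simp only [Set.mem_setOf_eq] at *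
    rw [mul_add, ha, hb]
  neg_mem' := by
    intro a ha
    simp only [Set.mem_setOf_eq] at *
    rw [mul_neg, ha]
  mul_mem' := by
    intro a b ha hb
    simp only [Set.mem_setOf_eq] at *
    rw [← mul_assoc, ha]

/-- The unital measure algebra `H_h = (hH, μ(·)/μ(h))`. -/
def corner (H : MeasureAlgebra) (h : H.carrier) : MeasureAlgebra where
  carrier := H.cornerSubring h
  idem := fun x => Subtype.ext (H.idem x.1)
  mu := fun x => H.mu x.1 / H.mu h
  mu_nonneg := fun a => div_nonneg (H.mu_nonneg a.1) (H.mu_nonneg h)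
  mu_eq_zero_iff := fun a => by
    constructor
    · intro ha
      rcases div_eq_zero_iff.mp ha with h' | h'
      · exact Subtype.ext ((H.mu_eq_zero_iff a.1).mp h')
      · have hh : h = 0 := (H.mu_eq_zero_iff h).mp h'
        have h2 : h * (a : H.carrier) = a := a.2
        apply Subtype.ext
        show (a : H.carrier) = 0
        generalize hx : (a : H.carrier) = x at h2 ⊢
        rw [← h2, hh, zero_mul]
    · intro h'
      subst h'
      have h0 : H.mu ((0 : H.cornerSubring h) : H.carrier) = 0 :=
        (H.mu_eq_zero_iff _).mpr rfl
      show H.mu ((0 : H.cornerSubring h) : H.carrier) / H.mu h = 0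
      rw [h0, zero_div]
  mu_add := fun a b hab => by
    have : H.mu ((a : H.carrier) + b) = H.mu a + H.mu b :=
      H.mu_add a.1 b.1 (congrArg Subtype.val hab)
    show H.mu ((a + b : H.cornerSubring h) : H.carrier) / H.mu h = _
    rw [show ((a + b : H.cornerSubring h) : H.carrier) = (a : H.carrier) + b from rfl,
      this, add_div]

/-- `D(H)`: the set of `n` such that `H` has a subalgebra containing the identity of `H`
and isomorphic to the standard measure algebra `Stₙ`. -/
def D (H : MeasureAlgebra) : Set ℕ :=
  {n | ∃ S : NonUnitalSubring H.carrier,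
    (∃ e ∈ S, ∀ x : H.carrier, e * x = x) ∧ (H.restrict S).Isomorphic (St n)}

/-- The Steinitz number `st(H)` of a (unital locally standard) measure algebra:
the least common multiple of `D(H)`. -/
def st (H : MeasureAlgebra) : SteinitzNumber :=
  fun p => ⨆ n ∈ H.D, (n.factorization p : ℕ∞)

/-- The spectrum of a measure algebra: the set of Steinitz numbers `st(H_h)` for `h ≠ 0`. -/
def Spec (H : MeasureAlgebra) : Set SteinitzNumber :=
  {s | ∃ h : H.carrier, h ≠ 0 ∧ (H.corner h).st = s}

end MeasureAlgebra

/-! ### Locally matrix algebras -/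

section LocallyMatrix

variable (F : Type) [Field F]

variable {A : Type} [NonUnitalRing A] [Module F A] [SMulCommClass F A A] [IsScalarTower F A A]

/-- The corner `uAu` of an algebra `A` at an idempotent `u`, as a subalgebra. -/
def cornerSubalg (u : A) : NonUnitalSubalgebra F A where
  carrier := {x | u * x = x ∧ x * u = x}
  zero_mem' := ⟨mul_zero u, zero_mul u⟩
  add_mem' := by
    rintro a b ⟨ha1, ha2⟩ ⟨hb1, hb2⟩
    exact ⟨by rw [mul_add, ha1, hb1], by rw [add_mul, ha2, hb2]⟩
  mul_mem' := by
    rintro a b ⟨ha1, ha2⟩ ⟨hb1, hb2⟩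
    exact ⟨by rw [← mul_assoc, ha1], by rw [mul_assoc, hb2]⟩
  smul_mem' := by
    rintro c a ⟨ha1, ha2⟩
    exact ⟨by rw [mul_smul_comm, ha1], by rw [smul_mul_assoc, ha2]⟩

/-- The subalgebra `S` is isomorphic to the matrix algebra `Mₙ(F)` as an `F`-algebra. -/
def IsMatrixSubalg (S : NonUnitalSubalgebra F A) (n : ℕ) : Prop :=
  ∃ φ : S ≃+* Matrix (Fin n) (Fin n) F, ∀ (c : F) (x : S), φ (c • x) = c • φ x

variable (A) in
/-- A locally matrix algebra: every finite collection of elements is contained in a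
subalgebra isomorphic to a matrix algebra `Mₙ(F)`. -/
def IsLocallyMatrix : Prop :=
  ∀ t : Finset A, ∃ (n : ℕ) (S : NonUnitalSubalgebra F A),
    (↑t : Set A) ⊆ S ∧ IsMatrixSubalg F S n

/-- `D(uAu)`: the set of `n` such that the (unital) corner algebra `uAu` contains a
subalgebra containing `u` and isomorphic to `Mₙ(F)`. -/
def cornerD (u : A) : Set ℕ :=
  {n | ∃ S : NonUnitalSubalgebra F A, u ∈ S ∧ S ≤ cornerSubalg F u ∧ IsMatrixSubalg F S n}

/-- The Steinitz number `st(uAu)` of the corner `uAu`: the least common multiple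
of `D(uAu)`. -/
noncomputable def cornerSt (u : A) : SteinitzNumber :=
  fun p => ⨆ n ∈ cornerD F u, (n.factorization p : ℕ∞)

variable (A) in
/-- The spectrum of a locally matrix algebra: `Spec(A) = { st(eAe) : 0 ≠ e = e² ∈ A }`. -/
def lmSpec : Set SteinitzNumber :=
  {s | ∃ e : A, e ≠ 0 ∧ e * e = e ∧ cornerSt F e = s}

/-- `C` is a Cartan subalgebra of the (unital) corner algebra `uAu`: there are tensor
product decompositions `uAu = ⊗ᵢ Tᵢ` and `C = ⊗ᵢ Dᵢ` with each `Tᵢ` a matrix algebra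
`M_{nᵢ}(F)` and `Dᵢ ⊆ Tᵢ` a Cartan subalgebra of `Tᵢ`, i.e. the span of `nᵢ` pairwise
orthogonal nonzero idempotents summing to the identity `u`. (Pairwise commuting unital
matrix subalgebras generating `uAu` automatically form a tensor product decomposition,
since a tensor product of matrix algebras is simple.) -/
def IsCartanSubalgebraOf (u : A) (C : NonUnitalSubalgebra F A) : Prop :=
  ∃ (T : ℕ → NonUnitalSubalgebra F A) (n : ℕ → ℕ) (E : (i : ℕ) → Fin (n i) → A),
    (∀ i, T i ≤ cornerSubalg F u) ∧
    (∀ i, IsMatrixSubalg F (T i) (n i)) ∧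
    (∀ i j, i ≠ j → ∀ x ∈ T i, ∀ y ∈ T j, x * y = y * x) ∧
    (⨆ i, T i) = cornerSubalg F u ∧
    (∀ i, (∀ k, E i k ∈ T i) ∧ (∀ k, E i k ≠ 0) ∧ (∀ k, E i k * E i k = E i k) ∧
      (∀ k l, k ≠ l → E i k * E i l = 0) ∧ (∑ k, E i k) = u) ∧
    C = ⨆ i, NonUnitalAlgebra.adjoin F (Set.range (E i))

end LocallyMatrix

/-! ### Systems of matrix units -/

/-- A system of matrix units indexed by `ι` whose diagonal idempotents sum to `u`. -/
structure IsMatrixUnits {ι A : Type} [Fintype ι] [DecidableEq ι] [Ring A]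
    (b : ι → ι → A) (u : A) : Prop where
  mul_eq : ∀ i j k l, b i j * b k l = if j = k then b i l else 0
  sum_eq : ∑ i, b i i = u

namespace IsMatrixUnits

variable {ι κ A : Type} [Fintype ι] [DecidableEq ι] [Fintype κ] [DecidableEq κ] [Ring A]
  {b : ι → ι → A} {c : κ → κ → A} {u v : A}

theorem mul_same (h : IsMatrixUnits b u) (i j l : ι) : b i j * b j l = b i l := by
  rw [h.mul_eq, if_pos rfl]

theorem unit_mul (h : IsMatrixUnits b u) (i j : ι) : u * b i j = b i j := by
  simp [← h.sum_eq, Finset.sum_mul, h.mul_eq]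

theorem mul_unit (h : IsMatrixUnits b u) (i j : ι) : b i j * u = b i j := by
  simp [← h.sum_eq, Finset.mul_sum, h.mul_eq]

theorem ne_zero (h : IsMatrixUnits b u) (hu : u ≠ 0) (i j : ι) : b i j ≠ 0 := by
  intro h0
  apply hu
  rw [← h.sum_eq]
  refine Finset.sum_eq_zero fun k _ => ?_
  rw [← h.mul_same k i k, ← h.mul_same i j k, h0, zero_mul, mul_zero]

theorem reindex (h : IsMatrixUnits b u) (f : κ ≃ ι) :
    IsMatrixUnits (fun i j => b (f i) (f j)) u where
  mul_eq i j k l := by simp [h.mul_eq]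
  sum_eq := by rw [← h.sum_eq]; exact f.sum_comp fun i => b i i

/-- The product of two commuting systems of matrix units with the same unit. -/
theorem prod (hb : IsMatrixUnits b u) (hc : IsMatrixUnits c u)
    (hbc : ∀ i j k l, Commute (b i j) (c k l)) :
    IsMatrixUnits (fun p q : ι × κ => b p.1 q.1 * c p.2 q.2) u where
  mul_eq := by
    rintro ⟨i, i'⟩ ⟨j, j'⟩ ⟨k, k'⟩ ⟨l, l'⟩
    dsimp only
    rw [mul_assoc, ← mul_assoc (c i' j'), ← (hbc k l i' j').eq, mul_assoc, ← mul_assoc, hb.mul_eq,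
      hc.mul_eq]
    by_cases h : j = k <;> by_cases h' : j' = k' <;> simp [h, h']
  sum_eq := by
    rw [Fintype.sum_prod_type]
    simp_rw [← Finset.mul_sum, hc.sum_eq, hb.mul_unit, hb.sum_eq]

variable (F : Type) [Field F] [Algebra F A]

/-- The homomorphism from a matrix algebra given by a system of matrix units. -/
def toHom (h : IsMatrixUnits b u) : Matrix ι ι F →ₙₐ[F] A where
  toFun M := ∑ i, ∑ j, M i j • b i j
  map_smul' r M := by simp [Finset.smul_sum, smul_smul]
  map_zero' := by simp
  map_add' M N := by simp [add_smul, Finset.sum_add_distrib]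
  map_mul' M N := by
    rw [Finset.sum_mul]
    refine Finset.sum_congr rfl fun i _ => ?_
    simp_rw [Matrix.mul_apply, Finset.sum_smul]
    rw [Finset.sum_mul]
    refine Finset.sum_comm.trans (Finset.sum_congr rfl fun j _ => ?_)
    rw [Finset.mul_sum, eq_comm, Finset.sum_eq_single j]
    · simp [Finset.mul_sum, h.mul_eq, smul_smul, mul_comm]
    · intro k _ hk
      simp [Finset.mul_sum, h.mul_eq, hk.symm]
    · simp

theorem toHom_apply (h : IsMatrixUnits b u) (M : Matrix ι ι F) :
    h.toHom F M = ∑ i, ∑ j, M i j • b i j := rfl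

/-- The subalgebra spanned by a system of matrix units. -/
def subalg (h : IsMatrixUnits b u) : NonUnitalSubalgebra F A :=
  NonUnitalAlgHom.range (h.toHom F)

theorem mem_subalg_iff (h : IsMatrixUnits b u) (x : A) :
    x ∈ h.subalg F ↔ ∃ M : Matrix ι ι F, ∑ i, ∑ j, M i j • b i j = x := Iff.rfl

theorem mem_subalg (h : IsMatrixUnits b u) (i j : ι) : b i j ∈ h.subalg F := by
  refine (h.mem_subalg_iff F _).2 ⟨Matrix.single i j 1, ?_⟩
  simp [Matrix.single_apply, ite_and]

theorem subalg_le (h : IsMatrixUnits b u) {S : NonUnitalSubalgebra F A}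
    (hS : ∀ i j, b i j ∈ S) : h.subalg F ≤ S := by
  intro x hx
  obtain ⟨M, rfl⟩ := (h.mem_subalg_iff F _).1 hx
  exact sum_mem fun i _ => sum_mem fun j _ => SMulMemClass.smul_mem _ (hS i j)

theorem subalg_le_corner (h : IsMatrixUnits b u) : h.subalg F ≤ cornerSubalg F u :=
  h.subalg_le F fun i j => ⟨h.unit_mul i j, h.mul_unit i j⟩

theorem toHom_injective (h : IsMatrixUnits b u) (hu : u ≠ 0) :
    Function.Injective (h.toHom F) := by
  rw [injective_iff_map_eq_zero]
  intro M hM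
  ext i j
  have h1 : b i i * h.toHom F M * b j j = M i j • b i j := by
    simp [toHom_apply, Finset.mul_sum, Finset.sum_mul, h.mul_eq]
  rw [hM, mul_zero, zero_mul] at h1
  exact (smul_eq_zero.1 h1.symm).resolve_right (h.ne_zero hu i j)

theorem isMatrixSubalg {n : ℕ} {b : Fin n → Fin n → A} (h : IsMatrixUnits b u) (hu : u ≠ 0) :
    IsMatrixSubalg F (h.subalg F) n := by
  let f : Matrix (Fin n) (Fin n) F ≃ h.subalg F :=
    Equiv.ofInjective (h.toHom F) (h.toHom_injective F hu)
  let g : Matrix (Fin n) (Fin n) F ≃+* h.subalg F :=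
    { f with
      map_mul' := fun x y => Subtype.ext (map_mul (h.toHom F) x y)
      map_add' := fun x y => Subtype.ext (map_add (h.toHom F) x y) }
  refine ⟨g.symm, fun c x => ?_⟩
  rw [RingEquiv.symm_apply_eq]
  refine Subtype.ext ?_
  change (c • x : A) = h.toHom F (c • g.symm x)
  rw [map_smul]
  exact congrArg (fun y : h.subalg F => c • (y : A)) (g.apply_symm_apply x).symm

theorem commute_of_subalg (h : IsMatrixUnits b u) (h' : IsMatrixUnits c v)
    (hbc : ∀ i j k l, Commute (b i j) (c k l)) {x y : A} (hx : x ∈ h.subalg F)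
    (hy : y ∈ h'.subalg F) : Commute x y := by
  obtain ⟨M, rfl⟩ := (h.mem_subalg_iff F _).1 hx
  obtain ⟨N, rfl⟩ := (h'.mem_subalg_iff F _).1 hy
  exact Commute.sum_left _ _ _ fun i _ => Commute.sum_left _ _ _ fun j _ =>
    Commute.sum_right _ _ _ fun k _ => Commute.sum_right _ _ _ fun l _ =>
    ((hbc i j k l).smul_left _).smul_right _

/-- A sequence of commuting systems of matrix units generating a corner gives a Cartan
subalgebra of that corner. -/
theorem isCartanSubalgebraOf (hu : u ≠ 0) {n : ℕ → ℕ} {U : (i : ℕ) → Fin (n i) → Fin (n i) → A}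
    (hU : ∀ i, IsMatrixUnits (U i) u)
    (hcomm : ∀ i j, i ≠ j → ∀ k l p q, Commute (U i k l) (U j p q))
    (hgen : cornerSubalg F u ≤ ⨆ i, (hU i).subalg F) :
    IsCartanSubalgebraOf F u
      (⨆ i, NonUnitalAlgebra.adjoin F (Set.range fun k => U i k k)) :=
  ⟨fun i => (hU i).subalg F, n, fun i k => U i k k, fun i => (hU i).subalg_le_corner F,
    fun i => (hU i).isMatrixSubalg F hu,
    fun i j hij _ hx _ hy => ((hU i).commute_of_subalg F (hU j) (hcomm i j hij) hx hy).eq,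
    le_antisymm (iSup_le fun i => (hU i).subalg_le_corner F) hgen,
    fun i => ⟨fun k => (hU i).mem_subalg F k k, fun k => (hU i).ne_zero hu k k,
      fun k => (hU i).mul_same k k k, fun k l hkl => by simp [(hU i).mul_eq, hkl],
      (hU i).sum_eq⟩, rfl⟩

end IsMatrixUnits

/-! ### Matrix algebras over a field -/

section Matrix

variable {F : Type} [Field F]

/-- Any complete system of `n` orthogonal nonzero idempotents of `Mₙ(F)` is conjugate to the
system of diagonal matrix units. -/
theorem Matrix.exists_conj_single_of_orthogonal_idempotents {n : ℕ}
    (E : Fin n → Matrix (Fin n) (Fin n) F)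
    (h0 : ∀ k, E k ≠ 0) (hid : ∀ k, E k * E k = E k) (hort : ∀ k l, k ≠ l → E k * E l = 0) :
    ∃ P Q : Matrix (Fin n) (Fin n) F, P * Q = 1 ∧ Q * P = 1 ∧
      ∀ k, P * Matrix.single k k 1 * Q = E k := by
  have hcol : ∀ k, ∃ j i, E k i j ≠ 0 := by
    intro k
    by_contra! h
    exact h0 k (by ext i j; exact h j i)
  choose j i hij using hcol
  let P : Matrix (Fin n) (Fin n) F := Matrix.of fun a k => E k a (j k)
  have hEP : ∀ k, E k * P = P * Matrix.single k k 1 := by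
    intro k
    ext a l
    have h1 : (E k * P) a l = (E k * E l) a (j l) := by simp [Matrix.mul_apply, P]
    rw [h1]
    rcases eq_or_ne k l with rfl | hkl
    · simp [hid, P]
    · rw [hort k l hkl, Matrix.mul_single_apply_of_ne _ _ _ _ _ hkl.symm]; rfl
  have hinj : Function.Injective P.mulVec := by
    have : Function.Injective P.mulVecLin := by
      rw [injective_iff_map_eq_zero]
      intro c hc
      rw [Matrix.mulVecLin_apply] at hc
      funext k
      have h1 : (E k * P).mulVec c = 0 := by rw [← Matrix.mulVec_mulVec, hc, Matrix.mulVec_zero]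
      rw [hEP, ← Matrix.mulVec_mulVec] at h1
      rw [Matrix.single_mulVec, one_mul] at h1
      change P.mulVec (Pi.single k (c k)) = 0 at h1
      rw [Matrix.mulVec_single] at h1
      simpa [P, hij k] using congrFun h1 (i k)
    exact this
  have hP := (Matrix.isUnit_iff_isUnit_det P).1 (Matrix.mulVec_injective_iff_isUnit.1 hinj)
  refine ⟨P, P⁻¹, Matrix.mul_nonsing_inv P hP, Matrix.nonsing_inv_mul P hP, fun k => ?_⟩
  rw [← hEP, mul_assoc, Matrix.mul_nonsing_inv P hP, mul_one]

/-- Rank factorization of an idempotent matrix. -/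
theorem Matrix.exists_factorization_of_idempotent {ι : Type} [Fintype ι] [DecidableEq ι]
    (G : Matrix ι ι F) (hG : G * G = G) :
    ∃ (d : ℕ) (X : Matrix ι (Fin d) F) (Y : Matrix (Fin d) ι F), Y * X = 1 ∧ X * Y = G := by
  let f := Matrix.toLin' G
  let bs := Module.finBasis F f.range
  refine ⟨_, LinearMap.toMatrix' (f.range.subtype ∘ₗ bs.equivFun.symm.toLinearMap),
    LinearMap.toMatrix' (bs.equivFun.toLinearMap ∘ₗ f.rangeRestrict), ?_, ?_⟩
  · rw [← LinearMap.toMatrix'_comp, ← LinearMap.toMatrix'_id]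
    congr 1
    refine LinearMap.ext fun v => ?_
    have key : ∀ w : f.range, f.rangeRestrict w = w := by
      rintro ⟨_, z, rfl⟩
      refine Subtype.ext ?_
      change f (f z) = f z
      simp [f, Matrix.mulVec_mulVec, hG]
    simp only [LinearMap.comp_apply, LinearEquiv.coe_coe, Submodule.subtype_apply, key,
      LinearEquiv.apply_symm_apply, LinearMap.id_apply]
  · rw [← LinearMap.toMatrix'_comp, ← LinearMap.toMatrix'_toLin' G]
    congr 1
    refine LinearMap.ext fun v => ?_
    simp [f]

end Matrix

section

variable (F : Type) [Field F] {A : Type} [Ring A] [Algebra F A]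

/-- A Cartan subalgebra of a matrix subalgebra is the diagonal of some system of matrix units. -/
theorem IsMatrixSubalg.exists_matrixUnits {T : NonUnitalSubalgebra F A} {n : ℕ}
    (hT : IsMatrixSubalg F T n) {u : A} {E : Fin n → A} (hET : ∀ k, E k ∈ T)
    (h0 : ∀ k, E k ≠ 0) (hid : ∀ k, E k * E k = E k)
    (hort : ∀ k l, k ≠ l → E k * E l = 0) (hsum : ∑ k, E k = u) :
    ∃ (b : Fin n → Fin n → A) (h : IsMatrixUnits b u), (∀ k, b k k = E k) ∧ h.subalg F = T := by
  obtain ⟨φ, hφ⟩ := hT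
  obtain ⟨P, Q, hPQ, hQP, hE⟩ := Matrix.exists_conj_single_of_orthogonal_idempotents
    (fun k => φ ⟨E k, hET k⟩)
    (fun k h => h0 k (congrArg Subtype.val ((map_eq_zero_iff φ φ.injective).1 h)))
    (fun k => by rw [← map_mul]; exact congrArg φ (Subtype.ext (hid k)))
    (fun k l hkl => by
      rw [← map_mul, map_eq_zero_iff φ φ.injective]; exact Subtype.ext (hort k l hkl))
  let b : Fin n → Fin n → A := fun k l => (φ.symm (P * Matrix.single k l 1 * Q) : T)
  have hb : ∀ k, b k k = E k := fun k => by
    change ((φ.symm (P * Matrix.single k k 1 * Q) : T) : A) = E k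
    rw [hE, φ.symm_apply_apply]
  have h : IsMatrixUnits b u := by
    refine ⟨fun i j k l => ?_, by simp_rw [hb]; exact hsum⟩
    have h1 : (P * Matrix.single i j 1 * Q) * (P * Matrix.single k l 1 * Q) =
        P * (Matrix.single i j 1 * Matrix.single k l (1 : F)) * Q := by
      simp only [mul_assoc]
      rw [← mul_assoc Q P, hQP, one_mul]
    simp only [b]
    rw [← NonUnitalSubalgebra.coe_mul, ← map_mul, h1]
    split_ifs with hjk
    · subst hjk; simp
    · simp [hjk]
  refine ⟨b, h, hb, le_antisymm (h.subalg_le F fun i j => Subtype.property _) fun x hx => ?_⟩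
  have hsymm : ∀ (c : F) (M : Matrix (Fin n) (Fin n) F), φ.symm (c • M) = c • φ.symm M := by
    intro c M
    rw [RingEquiv.symm_apply_eq, hφ, RingEquiv.apply_symm_apply]
  let M := Q * φ ⟨x, hx⟩ * P
  have hM : (⟨x, hx⟩ : T) = ∑ i, ∑ j, M i j • φ.symm (P * Matrix.single i j 1 * Q) := by
    rw [← φ.symm_apply_apply ⟨x, hx⟩]
    simp_rw [← hsymm, ← map_sum]
    congr 1
    have : φ ⟨x, hx⟩ = P * M * Q := by
      simp only [M, mul_assoc, hPQ, mul_one]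
      rw [← mul_assoc, hPQ, one_mul]
    rw [this]
    conv_lhs => rw [Matrix.matrix_eq_sum_single M]
    rw [Finset.mul_sum, Finset.sum_mul]
    refine Finset.sum_congr rfl fun i _ => ?_
    rw [Finset.mul_sum, Finset.sum_mul]
    refine Finset.sum_congr rfl fun j _ => ?_
    rw [← smul_mul_assoc, ← mul_smul_comm, Matrix.smul_single, smul_eq_mul, mul_one]
  refine (h.mem_subalg_iff F x).2 ⟨M, ?_⟩
  have := congrArg (Subtype.val : T → A) hM
  simpa [b] using this.symm

/-- In a unital locally matrix algebra the complement of a nonzero idempotent `e` is a sum of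
idempotents equivalent to one fixed idempotent `g` of the corner at `e`. -/
theorem IsLocallyMatrix.exists_complement_decomposition (hlm : IsLocallyMatrix F A) {e : A}
    (he : e ≠ 0) (hidem : e * e = e) :
    ∃ (g : A) (d : ℕ) (x y : Fin d → A), e * g = g ∧ g * e = g ∧ g * g = g ∧
      (∀ k, x k * g = x k) ∧ (∀ k l, y k * x l = if k = l then g else 0) ∧
      ∑ k, x k * y k = 1 - e := by
  classical
  obtain ⟨n, S, hS, φ, -⟩ := hlm {1, e}
  have h1 : (1 : A) ∈ S := hS (by simp)
  have h2 : e ∈ S := hS (by simp)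
  have hφ1 : φ ⟨1, h1⟩ = 1 := by
    have : (⟨1, h1⟩ : S) * φ.symm 1 = φ.symm 1 := Subtype.ext (one_mul _)
    simpa using congrArg φ this
  let ψ : Matrix (Fin n) (Fin n) F →ₙ+* A :=
    { toFun := fun M => (φ.symm M : S)
      map_mul' := fun M N => by simp
      map_zero' := by simp
      map_add' := fun M N => by simp }
  have hψ1 : ψ 1 = 1 := by
    change ((φ.symm 1 : S) : A) = 1
    rw [← hφ1, φ.symm_apply_apply]
  set G := φ ⟨e, h2⟩ with hGdef
  have hψG : ψ G = e := by
    change ((φ.symm G : S) : A) = e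
    rw [hGdef, φ.symm_apply_apply]
  have hGG : G * G = G := by rw [hGdef, ← map_mul]; exact congrArg φ (Subtype.ext hidem)
  have hG0 : G ≠ 0 := fun h => he (by rw [← hψG, h, map_zero])
  obtain ⟨d, X, Y, hYX, hXY⟩ := Matrix.exists_factorization_of_idempotent (1 - G)
    (by rw [mul_sub, sub_mul, sub_mul, hGG]; simp)
  obtain ⟨r, X', Y', hYX', hXY'⟩ := Matrix.exists_factorization_of_idempotent G hGG
  rcases Nat.eq_zero_or_pos r with rfl | hr
  · exact absurd (by rw [← hXY']; ext; simp [Matrix.mul_apply]) hG0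
  let o : Fin r := ⟨0, hr⟩
  have hGX : G * X' = X' := by rw [← hXY', Matrix.mul_assoc, hYX', Matrix.mul_one]
  have hYG : Y' * G = Y' := by rw [← hXY', ← Matrix.mul_assoc, hYX', Matrix.one_mul]
  have aux : ∀ {p q s t v w : ℕ} (L : Matrix (Fin p) (Fin q) F) (M : Matrix (Fin q) (Fin s) F)
      (N : Matrix (Fin s) (Fin t) F) (L' : Matrix (Fin t) (Fin s) F)
      (M' : Matrix (Fin s) (Fin v) F) (N' : Matrix (Fin v) (Fin w) F), N * L' = 1 →
      (L * M * N) * (L' * M' * N') = L * (M * M') * N' := by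
    intro p q s t v w L M N L' M' N' h
    simp only [Matrix.mul_assoc]
    rw [← Matrix.mul_assoc N L', h, Matrix.one_mul]
  let R : Matrix (Fin r) (Fin r) F := Matrix.single o o 1
  let R₁ : Fin d → Matrix (Fin d) (Fin r) F := fun k => Matrix.single k o 1
  let R₂ : Fin d → Matrix (Fin r) (Fin d) F := fun k => Matrix.single o k 1
  refine ⟨ψ (X' * R * Y'), d, fun k => ψ (X * R₁ k * Y'), fun k => ψ (X' * R₂ k * Y), ?_, ?_, ?_, ?_, ?_, ?_⟩
  · rw [← hψG, ← map_mul]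
    simp only [← Matrix.mul_assoc, hGX]
  · rw [← hψG, ← map_mul]
    simp only [Matrix.mul_assoc, hYG]
  · rw [← map_mul, aux _ _ _ _ _ _ hYX']; simp [R]
  · intro k
    rw [← map_mul, aux _ _ _ _ _ _ hYX']; simp [R, R₁]
  · intro k l
    rw [← map_mul, aux _ _ _ _ _ _ hYX]
    split_ifs with hkl
    · subst hkl; simp [R, R₁, R₂]
    · simp [R₁, R₂, hkl]
  · have : ∑ k, (X * R₁ k * Y') * (X' * R₂ k * Y) = 1 - G := by
      simp_rw [aux _ _ _ _ _ _ hYX', R₁, R₂, Matrix.single_mul_single_same]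
      rw [← Matrix.sum_mul, ← Matrix.mul_sum, mul_one, Matrix.sum_single_one, Matrix.mul_one, hXY]
    simp_rw [← map_mul]
    rw [← map_sum, this, map_sub, hψ1, hψG]

/-- An idempotent in the span of a system of matrix units is a sum of idempotents equivalent to
a diagonal matrix unit. -/
theorem IsMatrixUnits.exists_factorization {ι : Type} [Fintype ι] [DecidableEq ι]
    {b : ι → ι → A} {u : A} (h : IsMatrixUnits b u) (hu : u ≠ 0) (o : ι) {g : A}
    (hg : g ∈ h.subalg F) (hgg : g * g = g) :
    ∃ (d : ℕ) (x y : Fin d → A), (∀ k l, y k * x l = if k = l then b o o else 0) ∧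
      ∑ k, x k * y k = g ∧ (∀ k, x k * b o o = x k) ∧ ∀ k, b o o * y k = y k := by
  obtain ⟨G, rfl⟩ := hg
  have hGG : G * G = G := h.toHom_injective F hu (by rw [map_mul]; exact hgg)
  obtain ⟨d, X, Y, hYX, hXY⟩ := Matrix.exists_factorization_of_idempotent G hGG
  refine ⟨d, fun k => ∑ i, X i k • b i o, fun k => ∑ i, Y k i • b o i, ?_, ?_, ?_, ?_⟩
  · intro k l
    have : (Y * X) k l = if k = l then 1 else 0 := by rw [hYX, Matrix.one_apply]
    have h1 : (∑ i, Y k i • b o i) * (∑ i, X i l • b i o) = (Y * X) k l • b o o := by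
      rw [Finset.sum_mul, Matrix.mul_apply, Finset.sum_smul]
      refine Finset.sum_congr rfl fun i _ => ?_
      rw [Finset.mul_sum, Finset.sum_eq_single i]
      · rw [smul_mul_smul_comm, h.mul_same]
      · intro j _ hj
        rw [smul_mul_smul_comm, h.mul_eq, if_neg hj.symm, smul_zero]
      · simp
    change (∑ i, Y k i • b o i) * (∑ i, X i l • b i o) = _
    rw [h1, this, ite_zero_smul, one_smul]
  · change ∑ k, (∑ i, X i k • b i o) * (∑ j, Y k j • b o j) = ∑ i, ∑ j, G i j • b i j
    simp_rw [Finset.sum_mul_sum, smul_mul_smul_comm, h.mul_same, ← hXY, Matrix.mul_apply,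
      Finset.sum_smul]
    rw [Finset.sum_comm]
    exact Finset.sum_congr rfl fun i _ => Finset.sum_comm
  · intro k; simp [Finset.sum_mul, h.mul_eq]
  · intro k; simp [Finset.mul_sum, h.mul_eq]

theorem NonUnitalSubalgebra.exists_mem_iSup_lt {T : ℕ → NonUnitalSubalgebra F A} {x : A}
    (hx : x ∈ ⨆ i, T i) : ∃ m, x ∈ ⨆ i, ⨆ (_ : i < m), T i := by
  have hmono : Monotone fun m => ⨆ i, ⨆ (_ : i < m), T i := fun m m' hmm =>
    iSup_mono fun i => iSup_le fun hi => le_iSup_of_le (hi.trans_le hmm) le_rfl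
  have hle : ⨆ i, T i ≤ ⨆ m, ⨆ i, ⨆ (_ : i < m), T i := iSup_le fun i =>
    le_iSup_of_le (i + 1) (le_iSup_of_le i (le_iSup_of_le i.lt_succ_self le_rfl))
  have h := hle hx
  rw [← SetLike.mem_coe, NonUnitalSubalgebra.coe_iSup_of_directed hmono.directed_le] at h
  simpa using h

end

namespace IsMatrixUnits

variable {F : Type} [Field F] {A : Type} [Ring A] [Algebra F A]

/-- Finitely many commuting systems of matrix units in a corner are contained, together with their
diagonals, in the span of a single system commuting with the remaining ones. -/
theorem exists_initial_product {e : A} (hidem : e * e = e) {n : ℕ → ℕ}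
    {U : (i : ℕ) → Fin (n i) → Fin (n i) → A} (hU : ∀ i, IsMatrixUnits (U i) e)
    (hcomm : ∀ i j, i ≠ j → ∀ k l p q, Commute (U i k l) (U j p q)) (m : ℕ) :
    ∃ (ι : Type) (_ : Fintype ι) (_ : DecidableEq ι) (b : ι → ι → A) (h : IsMatrixUnits b e),
      (∀ i, m ≤ i → ∀ p q k l, Commute (b p q) (U i k l)) ∧
      (∀ i < m, ∀ k l, U i k l ∈ h.subalg F) ∧
      ∀ i < m, ∀ k, U i k k ∈ NonUnitalAlgebra.adjoin F (Set.range fun p => b p p) := by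
  induction m with
  | zero =>
    refine ⟨Unit, inferInstance, inferInstance, fun _ _ => e, ⟨by simp [hidem], by simp⟩,
      fun i _ _ _ k l => ?_, by simp, by simp⟩
    exact ((hU i).unit_mul k l).trans ((hU i).mul_unit k l).symm
  | succ m ih =>
    obtain ⟨ι, _, _, b, h, hbU, hmem, hdiag⟩ := ih
    have h' := h.prod (hU m) (hbU m le_rfl)
    have hU_eq : ∀ k l, U m k l = ∑ p, b p p * U m k l := fun k l => by
      rw [← Finset.sum_mul, h.sum_eq, (hU m).unit_mul]
    have hb_eq : ∀ p q, b p q = ∑ k, b p q * U m k k := fun p q => by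
      rw [← Finset.mul_sum, (hU m).sum_eq, h.mul_unit]
    have hbmem : ∀ p q, b p q ∈ h'.subalg F := fun p q => by
      rw [hb_eq]
      exact sum_mem fun k _ => h'.mem_subalg F (p, k) (q, k)
    have hmem_diag : ∀ p k, b p p * U m k k ∈ NonUnitalAlgebra.adjoin F
        (Set.range fun p : ι × Fin (n m) => b p.1 p.1 * U m p.2 p.2) := fun p k =>
      NonUnitalAlgebra.subset_adjoin F ⟨(p, k), rfl⟩
    refine ⟨ι × Fin (n m), inferInstance, inferInstance, _, h', ?_, ?_, ?_⟩
    · intro i hi p q k l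
      exact (hbU i (by omega) _ _ _ _).mul_left (hcomm m i (by omega) _ _ _ _)
    · intro i hi k l
      rcases Nat.lt_succ_iff_lt_or_eq.1 hi with hi | rfl
      · exact h.subalg_le F hbmem (hmem i hi k l)
      · rw [hU_eq]
        exact sum_mem fun p _ => h'.mem_subalg F (p, k) (p, l)
    · intro i hi k
      rcases Nat.lt_succ_iff_lt_or_eq.1 hi with hi | rfl
      · refine NonUnitalAlgebra.adjoin_le ?_ (hdiag i hi k)
        rintro _ ⟨p, rfl⟩
        dsimp only
        rw [SetLike.mem_coe, hb_eq]
        exact sum_mem fun k _ => hmem_diag p k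
      · rw [hU_eq]
        exact sum_mem fun p _ => hmem_diag p k

variable {ι κ : Type} [Fintype ι] [DecidableEq ι] [Fintype κ] [DecidableEq κ]

/-- A system of matrix units with unit `e` extends to one with unit `1` once `1 - e` is decomposed
into idempotents equivalent to a diagonal matrix unit. -/
theorem exists_extension {b : ι → ι → A} {e : A} (h : IsMatrixUnits b e) (o : ι) {x y : κ → A}
    (hyx : ∀ k l, y k * x l = if k = l then b o o else 0) (hxy : ∑ k, x k * y k = 1 - e)
    (hx : ∀ k, x k * b o o = x k) (hy : ∀ k, b o o * y k = y k) :
    ∃ q : ι ⊕ κ → ι ⊕ κ → A, IsMatrixUnits q 1 ∧ ∀ i j, q (.inl i) (.inl j) = b i j := by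
  have hex : ∀ k, e * x k = 0 := fun k => by
    have : (1 - e) * x k = x k := by simp [← hxy, Finset.sum_mul, mul_assoc, hyx, hx]
    rwa [sub_mul, one_mul, sub_eq_self] at this
  have hye : ∀ k, y k * e = 0 := fun k => by
    have : y k * (1 - e) = y k := by simp [← hxy, Finset.mul_sum, ← mul_assoc, hyx, hy]
    rwa [mul_sub, mul_one, sub_eq_self] at this
  let c : ι ⊕ κ → A := Sum.elim (fun i => b i o) x
  let r : ι ⊕ κ → A := Sum.elim (fun i => b o i) y
  have hc : ∀ j, c j * b o o = c j := by
    rintro (i | k)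
    · exact h.mul_same i o o
    · exact hx k
  have hrc : ∀ j k, r j * c k = if j = k then b o o else 0 := by
    rintro (i | k) (j | l)
    · simp [r, c, h.mul_eq]
    · change b o i * x l = _
      rw [← h.mul_unit, mul_assoc, hex]
      simp
    · change y k * b j o = _
      rw [← h.unit_mul, ← mul_assoc, hye]
      simp
    · simp [r, c, hyx]
  refine ⟨fun i j => c i * r j, ⟨fun i j k l => ?_, ?_⟩, fun i j => h.mul_same i o j⟩
  · rw [mul_assoc, ← mul_assoc (r j), hrc]
    split_ifs
    · rw [← mul_assoc, hc]
    · simp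
  · rw [Fintype.sum_sum_type]
    simp [c, r, h.mul_same, h.sum_eq, hxy]

/-- The diagonal embedding into the centralizer of a system of matrix units. -/
def spread (q : ι → ι → A) (o : ι) (z : A) : A := ∑ j, q j o * z * q o j

variable {q : ι → ι → A} {o : ι} {z w : A}

theorem mul_spread (h : IsMatrixUnits q 1) (i j : ι) :
    q i j * spread q o z = q i o * z * q o j := by
  rw [spread, Finset.mul_sum, Finset.sum_eq_single j]
  · rw [← mul_assoc, ← mul_assoc, h.mul_same]
  · intro k _ hk
    rw [← mul_assoc, ← mul_assoc, h.mul_eq, if_neg hk.symm, zero_mul, zero_mul]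
  · simp

theorem spread_mul (h : IsMatrixUnits q 1) (i j : ι) :
    spread q o z * q i j = q i o * z * q o j := by
  rw [spread, Finset.sum_mul, Finset.sum_eq_single i]
  · rw [mul_assoc, h.mul_same]
  · intro k _ hk
    rw [mul_assoc, h.mul_eq, if_neg hk, mul_zero]
  · simp

theorem commute_spread (h : IsMatrixUnits q 1) (i j : ι) : Commute (q i j) (spread q o z) :=
  (h.mul_spread i j).trans (h.spread_mul i j).symm

theorem spread_mul_spread (h : IsMatrixUnits q 1) (hz : Commute (q o o) z) :
    spread q o z * spread q o w = spread q o (z * w) := by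
  rw [spread, Finset.sum_mul, spread.eq_def q o (z * w)]
  refine Finset.sum_congr rfl fun j _ => ?_
  rw [mul_assoc, h.mul_spread, ← mul_assoc, ← mul_assoc, mul_assoc (q j o), ← hz.eq, ← mul_assoc,
    h.mul_same, mul_assoc (q j o)]

/-- Spreading a system of matrix units of a corner over the whole algebra. -/
theorem spread_units (h : IsMatrixUnits q 1) {e : A} (he : e * q o o = q o o)
    {U : κ → κ → A} (hU : IsMatrixUnits U e) (hqU : ∀ k l, Commute (q o o) (U k l)) :
    IsMatrixUnits (fun k l => spread q o (U k l)) 1 where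
  mul_eq i j k l := by
    rw [h.spread_mul_spread (hqU i j), hU.mul_eq]
    split_ifs
    · rfl
    · simp [spread]
  sum_eq := by
    simp_rw [spread]
    rw [Finset.sum_comm]
    simp_rw [← Finset.sum_mul, ← Finset.mul_sum, hU.sum_eq]
    rw [← h.sum_eq]
    refine Finset.sum_congr rfl fun j _ => ?_
    rw [← h.mul_same o o j, mul_assoc, ← mul_assoc e, he, h.mul_same, h.mul_same]

end IsMatrixUnits

/-- **Lemma 3.** Let `A` be a countable-dimensional unital locally matrix algebra over a
field `F`, let `0 ≠ e ∈ A` be an idempotent and `C` a Cartan subalgebra of `eAe`. Then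
there is a Cartan subalgebra of `A` containing `C`. -/
theorem cartan_of_corner_extends
    (F : Type) [Field F] (A : Type) [Ring A] [Algebra F A]
    (hdim : Module.rank F A ≤ Cardinal.aleph0)
    (hlm : IsLocallyMatrix F A)
    (e : A) (he : e ≠ 0) (hidem : e * e = e)
    (C : NonUnitalSubalgebra F A) (hC : IsCartanSubalgebraOf F e C) :
    ∃ C' : NonUnitalSubalgebra F A, IsCartanSubalgebraOf F (1 : A) C' ∧ C ≤ C' := by
  obtain ⟨T, n, E, hTe, hT, hTcomm, hTsup, hE, rfl⟩ := hC
  choose U hU hUE hUT using fun i => (hT i).exists_matrixUnits F (hE i).1 (hE i).2.1 (hE i).2.2.1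
    (hE i).2.2.2.1 (hE i).2.2.2.2
  have hUmem : ∀ i k l, U i k l ∈ T i := fun i k l => hUT i ▸ (hU i).mem_subalg F k l
  have hUcomm : ∀ i j, i ≠ j → ∀ k l p q, Commute (U i k l) (U j p q) :=
    fun i j hij k l p q => hTcomm i j hij _ (hUmem i k l) _ (hUmem j p q)
  obtain ⟨g, d, x, y, heg, hge, hgg, hxg, hyx, hxy⟩ :=
    hlm.exists_complement_decomposition F he hidem
  obtain ⟨m, hm⟩ := NonUnitalSubalgebra.exists_mem_iSup_lt F (T := T) (x := g)
    (by rw [hTsup]; exact ⟨heg, hge⟩)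
  obtain ⟨ι, _, _, b, hb, hbU, hUb, hUdiag⟩ :=
    IsMatrixUnits.exists_initial_product (F := F) hidem hU hUcomm m
  have hTb : ∀ i < m, T i ≤ hb.subalg F := fun i hi =>
    hUT i ▸ (hU i).subalg_le F (hUb i hi)
  have hgb : g ∈ hb.subalg F := (iSup_le fun i => iSup_le (hTb i) : _ ≤ hb.subalg F) hm
  obtain ⟨o⟩ : Nonempty ι := by
    by_contra h
    rw [not_nonempty_iff] at h
    exact he (by rw [← hb.sum_eq]; simp)
  obtain ⟨d', x', y', hyx', hxy', hx', hy'⟩ := hb.exists_factorization F he o hgb hgg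
  obtain ⟨q, hq, hqb⟩ := hb.exists_extension (κ := Fin d × Fin d') o
    (x := fun k => x k.1 * x' k.2) (y := fun k => y' k.2 * y k.1)
    (by
      rintro ⟨k, k'⟩ ⟨l, l'⟩
      have hgx : g * x' l' = x' l' := by simp [← hxy', Finset.sum_mul, mul_assoc, hyx', hx']
      dsimp only
      rw [mul_assoc, ← mul_assoc (y k), hyx]
      by_cases hkl : k = l <;> simp [hkl, hgx, hyx'])
    (by
      rw [Fintype.sum_prod_type, ← hxy]
      refine Finset.sum_congr rfl fun k _ => ?_
      simp_rw [mul_assoc, ← mul_assoc (x' _), ← Finset.mul_sum, ← Finset.sum_mul]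
      rw [hxy', ← mul_assoc, hxg])
    (fun k => by rw [mul_assoc, hx']) (fun k => by rw [← mul_assoc, hy'])
  have hqo : q (.inl o) (.inl o) = b o o := hqb o o
  let V : (i : ℕ) → Fin (n (m + i)) → Fin (n (m + i)) → A := fun i k l =>
    IsMatrixUnits.spread q (.inl o) (U (m + i) k l)
  have hqU : ∀ i k l, Commute (q (.inl o) (.inl o)) (U (m + i) k l) := fun i k l => by
    rw [hqo]; exact hbU _ (by omega) _ _ _ _
  have hV : ∀ i, IsMatrixUnits (V i) 1 := fun i =>
    hq.spread_units (by rw [hqo, hb.unit_mul]) (hU (m + i)) (hqU i)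
  have heq : ∑ p, q (.inl p) (.inl p) = e := by simp_rw [hqb, hb.sum_eq]
  have heV : ∀ i k l, e * V i k l = U (m + i) k l := fun i k l => by
    rw [← heq, Finset.sum_mul]
    simp_rw [V, hq.mul_spread, hqb]
    calc ∑ p, b p o * U (m + i) k l * b o p = ∑ p, b p p * U (m + i) k l := by
          refine Finset.sum_congr rfl fun p _ => ?_
          rw [mul_assoc, ← (hbU (m + i) (by omega) o p k l).eq, ← mul_assoc, hb.mul_same]
      _ = U (m + i) k l := by rw [← Finset.sum_mul, hb.sum_eq, (hU _).unit_mul]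
  let f := (Fintype.equivFin (ι ⊕ Fin d × Fin d')).symm
  let W : ℕ → (N : ℕ) × (Fin N → Fin N → A) := fun i =>
    Nat.casesOn i ⟨_, fun k l => q (f k) (f l)⟩ fun i => ⟨n (m + i), V i⟩
  have hW : ∀ i, IsMatrixUnits (W i).2 1 := by
    rintro (_ | i)
    · exact hq.reindex f
    · exact hV i
  have hVV : ∀ i j, i ≠ j → ∀ k l k' l', Commute (V i k l) (V j k' l') := by
    intro i j hij k l k' l'
    have h := hUcomm (m + i) (m + j) (by omega) k l k' l'
    exact (hq.spread_mul_spread (hqU i k l)).trans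
      ((congrArg _ h.eq).trans (hq.spread_mul_spread (hqU j k' l')).symm)
  have hWW : ∀ i j, i ≠ j → ∀ k l k' l', Commute ((W i).2 k l) ((W j).2 k' l') := by
    rintro (_ | i) (_ | j) hij k l k' l'
    · exact absurd rfl hij
    · exact hq.commute_spread _ _
    · exact (hq.commute_spread _ _).symm
    · exact hVV i j (by omega) k l k' l'
  have hqW : ∀ i j, q i j ∈ ⨆ i, (hW i).subalg F := fun i j => by
    have := (hW 0).mem_subalg F (f.symm i) (f.symm j)
    change q (f (f.symm i)) (f (f.symm j)) ∈ _ at this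
    rw [f.apply_symm_apply, f.apply_symm_apply] at this
    exact le_iSup (fun i => (hW i).subalg F) 0 this
  have hVW : ∀ i k l, V i k l ∈ ⨆ i, (hW i).subalg F := fun i k l =>
    le_iSup (fun i => (hW i).subalg F) (i + 1) ((hW (i + 1)).mem_subalg F k l)
  have hcorner : cornerSubalg F e ≤ ⨆ i, (hW i).subalg F := by
    rw [← hTsup]
    refine iSup_le fun i => ?_
    rcases lt_or_ge i m with hi | hi
    · exact (hTb i hi).trans (hb.subalg_le F fun i j => hqb i j ▸ hqW _ _)
    · obtain ⟨i, rfl⟩ := Nat.exists_eq_add_of_le hi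
      rw [← hUT]
      refine (hU _).subalg_le F fun k l => ?_
      rw [← heV, ← heq]
      exact mul_mem (sum_mem fun p _ => hqW _ _) (hVW i k l)
  have h1 : (1 : A) ≠ 0 := fun h => he (by rw [← one_mul e, h, zero_mul])
  refine ⟨_, IsMatrixUnits.isCartanSubalgebraOf F h1 hW hWW fun a _ => ?_, iSup_le fun i =>
    NonUnitalAlgebra.adjoin_le ?_⟩
  · have ha : a = ∑ i, ∑ j, q i (.inl o) * (q (.inl o) i * a * q j (.inl o)) * q (.inl o) j := by
      have : ∀ i j, q i (.inl o) * (q (.inl o) i * a * q j (.inl o)) * q (.inl o) j =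
          q i i * a * q j j := fun i j => by
        rw [← hq.mul_same i (.inl o) i, ← hq.mul_same j (.inl o) j]
        simp only [mul_assoc]
      simp_rw [this, ← Finset.mul_sum, ← Finset.sum_mul, hq.sum_eq]
      simp
    have heq' : ∀ j, e * q (.inl o) j = q (.inl o) j := fun j => by
      rw [← hq.mul_same _ (.inl o), hqo, ← mul_assoc, hb.unit_mul]
    have hqe : ∀ j, q j (.inl o) * e = q j (.inl o) := fun j => by
      rw [← hq.mul_same _ (.inl o), hqo, mul_assoc, hb.mul_unit]
    rw [ha]
    refine sum_mem fun i _ => sum_mem fun j _ => mul_mem (mul_mem (hqW _ _) (hcorner ⟨?_, ?_⟩))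
      (hqW _ _)
    · rw [← mul_assoc, ← mul_assoc, heq']
    · rw [mul_assoc, hqe]
  · rintro _ ⟨k, rfl⟩
    have hqC : ∀ j, q j j ∈
        ⨆ i, NonUnitalAlgebra.adjoin F (Set.range fun k => (W i).2 k k) := fun j =>
      le_iSup (fun i => NonUnitalAlgebra.adjoin F (Set.range fun k => (W i).2 k k)) 0
        (NonUnitalAlgebra.subset_adjoin F ⟨f.symm j, by simp [W]⟩)
    rw [SetLike.mem_coe, ← hUE]
    rcases lt_or_ge i m with hi | hi
    · refine NonUnitalAlgebra.adjoin_le ?_ (hUdiag i hi k)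
      rintro _ ⟨p, rfl⟩
      dsimp only
      rw [← hqb]
      exact hqC _
    · obtain ⟨i, rfl⟩ := Nat.exists_eq_add_of_le hi
      rw [← heV, ← heq]
      exact mul_mem (sum_mem fun p _ => hqC _)
        (le_iSup (fun i => NonUnitalAlgebra.adjoin F (Set.range fun k => (W i).2 k k)) (i + 1)
          (NonUnitalAlgebra.subset_adjoin F ⟨k, rfl⟩))
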